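/- arXiv:1605.03509 — 4 statements merged into one kernel-verified Lean document; each statement's English description precedes it below -/
import Mathlib

section
/- Let M be a real 3×3 matrix with det M > 0, and let A = M (√(MᵀM))⁻¹, where √(MᵀM) denotes the unique symmetric positive-definite square root of MᵀM (so A is the orthogonal factor of the polar decomposition of M). Then A ∈ SO(3), and for every B ∈ SO(3) one has B·M ≤ A·M, with equality if and only if B = A. In particular A is the unique maximizer of B ↦ B·M over SO(3). -/
open Matrix

noncomputable section

/-- `SO(3)`: real 3×3 matrices with `AᵀA = 1` and `det A = 1`. -/
def so3 (A : Matrix (Fin 3) (Fin 3) ℝ) : Prop := Aᵀ * A = 1 ∧ A.det = 1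

/-- The inner product `A·B = ½ tr(AᵀB)` on real 3×3 matrices. -/
def mdot (A B : Matrix (Fin 3) (Fin 3) ℝ) : ℝ := (1 / 2) * (Aᵀ * B).trace

theorem aux_tr (C S : Matrix (Fin 3) (Fin 3) ℝ) (hS : S.PosDef) :
    0 ≤ (C * S * Cᵀ).trace ∧ ((C * S * Cᵀ).trace = 0 → C = 0) := by
  have key : (C * S * Cᵀ).trace = ∑ i, C i ⬝ᵥ (S *ᵥ C i) := by
    simp only [Matrix.trace, Matrix.diag]
    refine Finset.sum_congr rfl fun i _ => ?_
    simp [Matrix.mul_apply, dotProduct, Matrix.mulVec, Fin.sum_univ_three]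
    ring
  have nn : ∀ i, 0 ≤ C i ⬝ᵥ (S *ᵥ C i) := fun i => by
    simpa using hS.posSemidef.dotProduct_mulVec_nonneg (C i)
  rw [key]
  refine ⟨Finset.sum_nonneg fun i _ => nn i, fun h => ?_⟩
  rw [Finset.sum_eq_zero_iff_of_nonneg fun i _ => nn i] at h
  funext i
  by_contra hne
  have h1 := hS.dotProduct_mulVec_pos (x := C i) hne
  have h2 := h i (Finset.mem_univ i)
  simp only [star_trivial] at h1
  linarith

theorem stmt1 (M S A : Matrix (Fin 3) (Fin 3) ℝ) (hdet : 0 < M.det)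
    (hSpd : S.PosDef) (hSsq : S * S = Mᵀ * M) (hA : A = M * S⁻¹) :
    so3 A ∧ ∀ B, so3 B → (mdot B M ≤ mdot A M ∧ (mdot B M = mdot A M ↔ B = A)) := by
  have hST : Sᵀ = S := by simpa using hSpd.isHermitian.eq
  have hSd : 0 < S.det := hSpd.det_pos
  have hSu : IsUnit S.det := hSd.ne'.isUnit
  have hM : A * S = M := by
    rw [hA, Matrix.mul_assoc, Matrix.nonsing_inv_mul _ hSu, Matrix.mul_one]
  have hAA : Aᵀ * A = 1 := by
    rw [hA, Matrix.transpose_mul, Matrix.transpose_nonsing_inv, hST]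
    calc S⁻¹ * Mᵀ * (M * S⁻¹) = S⁻¹ * (Mᵀ * M) * S⁻¹ := by simp only [Matrix.mul_assoc]
      _ = (S⁻¹ * S) * (S * S⁻¹) := by rw [← hSsq]; simp only [Matrix.mul_assoc]
      _ = 1 := by rw [Matrix.nonsing_inv_mul _ hSu, Matrix.mul_nonsing_inv _ hSu, Matrix.mul_one]
  have hAd : A.det = 1 := by
    have h1 : A.det * A.det = 1 := by
      simpa using congrArg Matrix.det hAA
    have h2 : A.det * S.det = M.det := by rw [← hM, Matrix.det_mul]
    have h3 : 0 < A.det := by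
      by_contra hn
      nlinarith
    nlinarith
  refine ⟨⟨hAA, hAd⟩, fun B hB => ?_⟩
  obtain ⟨h0, hz⟩ := aux_tr (A - B) S hSpd
  have e : ((A - B) * S * (A - B)ᵀ).trace = 4 * (mdot A M - mdot B M) := by
    have t1 : (A * S * Aᵀ).trace = S.trace := by
      rw [Matrix.trace_mul_comm, ← Matrix.mul_assoc, hAA, Matrix.one_mul]
    have t2 : (B * S * Bᵀ).trace = S.trace := by
      rw [Matrix.trace_mul_comm, ← Matrix.mul_assoc, hB.1, Matrix.one_mul]
    have t3 : (A * S * Bᵀ).trace = (Bᵀ * M).trace := by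
      rw [Matrix.trace_mul_comm, hM]
    have t4 : (B * S * Aᵀ).trace = (Bᵀ * M).trace := by
      rw [← t3, ← Matrix.trace_transpose]
      simp only [Matrix.transpose_mul, Matrix.transpose_transpose, hST, Matrix.mul_assoc]
    have t5 : (Aᵀ * M).trace = S.trace := by
      rw [← hM, ← Matrix.mul_assoc, hAA, Matrix.one_mul]
    simp only [mdot, Matrix.transpose_sub, Matrix.sub_mul, Matrix.mul_sub, Matrix.trace_sub,
      t1, t2, t3, t4, t5]
    ring
  rw [e] at h0 hz
  refine ⟨by linarith, fun h => ?_, fun h => by rw [h]⟩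
  exact (sub_eq_zero.mp (hz (by rw [h]; ring))).symm
end
end

section
/- (Consistency relation for the flux) Let ν : ℝ → (0, ∞) be continuous, let σ : ℝ → ℝ be an antiderivative of ν (σ′ = ν), and let d > 0. Let μ be the Haar probability measure on SO(3), and define m(θ) = exp(d⁻¹ σ(½ + cos θ)) for θ ∈ (0, π). Then for every Λ ∈ SO(3), the matrix-valued integral satisfies ∫_{SO(3)} A · exp(d⁻¹ σ(½ tr(Λᵀ A))) dμ(A) = c₁ · ( ∫_{SO(3)} exp(d⁻¹ σ(½ tr(Λᵀ A))) dμ(A) ) · Λ, where c₁ = (2/3) · ( ∫₀^π (½ + cos θ) sin²(θ/2) m(θ) dθ ) / ( ∫₀^π sin²(θ/2) m(θ) dθ ). -/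
open Matrix MeasureTheory

noncomputable section

instance : MeasurableSpace (Matrix (Fin 3) (Fin 3) ℝ) := MeasurableSpace.pi

abbrev M3 := Matrix (Fin 3) (Fin 3) ℝ

instance borelM3 : BorelSpace M3 := inferInstanceAs (BorelSpace (Fin 3 → Fin 3 → ℝ))
instance scM3 : SecondCountableTopology M3 :=
  inferInstanceAs (SecondCountableTopology (Fin 3 → Fin 3 → ℝ))

def K3 : Set M3 := Set.pi Set.univ (fun _ => Set.pi Set.univ (fun _ => Set.Icc (-1:ℝ) 1))

lemma K3_compact : IsCompact K3 :=
  isCompact_univ_pi (fun _ => isCompact_univ_pi (fun _ => isCompact_Icc))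

lemma so3.mul_tr {A : M3} (h : so3 A) : A * Aᵀ = 1 := mul_eq_one_comm.mp h.1

lemma so3.tr {A : M3} (h : so3 A) : so3 Aᵀ :=
  ⟨by rw [transpose_transpose]; exact h.mul_tr, by rw [det_transpose]; exact h.2⟩

lemma so3.mem {A : M3} (h : so3 A) : A ∈ K3 := by
  intro i _ j _
  have h1 := congrFun (congrFun h.1 j) j
  simp [Matrix.mul_apply, Fin.sum_univ_three] at h1
  have : A i j ^ 2 ≤ 1 := by
    fin_cases i <;> simp only [Fin.mk_one, Fin.zero_eta, Fin.reduceFinMk] <;>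
      nlinarith [sq_nonneg (A 0 j), sq_nonneg (A 1 j), sq_nonneg (A 2 j)]
  exact ⟨by nlinarith, by nlinarith⟩

lemma so3.ident {A : M3} (h : so3 A) :
    (A 0 1 - A 1 0)^2 + (A 1 2 - A 2 1)^2 + (A 2 0 - A 0 2)^2 = (3 - A.trace) * (1 + A.trace) := by
  have hadj : A.adjugate = Aᵀ := by
    have h1 : A.adjugate * A = 1 := by rw [adjugate_mul, h.2, one_smul]
    calc A.adjugate = A.adjugate * (A * Aᵀ) := by rw [h.mul_tr, mul_one]
      _ = Aᵀ := by rw [← mul_assoc, h1, one_mul]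
  have e : ∀ i, A.adjugate i i = A i i := fun i => by rw [hadj]; rfl
  have e0 := e 0
  have e1 := e 1
  have e2 := e 2
  rw [adjugate_fin_three] at e0 e1 e2
  have h0 := congrFun (congrFun h.1 0) 0
  have h1 := congrFun (congrFun h.1 1) 1
  have h2 := congrFun (congrFun h.1 2) 2
  simp [Matrix.mul_apply, Fin.sum_univ_three] at h0 h1 h2 e0 e1 e2
  simp only [trace_fin_three]
  linear_combination h0 + h1 + h2 + 2 * e0 + 2 * e1 + 2 * e2

lemma so3.range {A : M3} (h : so3 A) : A.trace ∈ Set.Icc (-1:ℝ) 3 := by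
  have := h.ident
  have h2 : 0 ≤ (3 - A.trace) * (1 + A.trace) := by rw [← this]; positivity
  constructor <;> nlinarith

section
variable {μ : Measure M3} [IsProbabilityMeasure μ]

lemma integ (hs : ∀ᵐ A ∂μ, so3 A) {f : M3 → ℝ} (hf : Continuous f) : Integrable f μ := by
  obtain ⟨C, hC⟩ := K3_compact.exists_bound_of_continuousOn hf.continuousOn
  exact Integrable.of_bound hf.aestronglyMeasurable C (hs.mono fun A hA => hC A hA.mem)

lemma linv (hi : ∀ g, so3 g → Measure.map (fun A => g * A) μ = μ) {f : M3 → ℝ}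
    (hf : Continuous f) {g : M3} (hg : so3 g) : ∫ A, f (g * A) ∂μ = ∫ A, f A ∂μ := by
  have hc : Continuous (fun A : M3 => g * A) := by fun_prop
  conv_rhs => rw [← hi g hg]
  rw [integral_map hc.aemeasurable hf.aestronglyMeasurable]

lemma tinv (hs : ∀ᵐ A ∂μ, so3 A)
    (hi : ∀ g, so3 g → Measure.map (fun A => g * A) μ = μ) {f : M3 → ℝ}
    (hf : Continuous f) : ∫ A, f Aᵀ ∂μ = ∫ A, f A ∂μ := by
  have hc : Continuous (fun p : M3 × M3 => f (p.1ᵀ * p.2)) := by fun_prop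
  have hint : Integrable (fun p : M3 × M3 => f (p.1ᵀ * p.2)) (μ.prod μ) := by
    obtain ⟨C, hC⟩ := (K3_compact.prod K3_compact).exists_bound_of_continuousOn hc.continuousOn
    refine Integrable.of_bound hc.aestronglyMeasurable C ?_
    have h1 := Measure.quasiMeasurePreserving_fst (μ := μ) (ν := μ) |>.ae hs
    have h2 := Measure.quasiMeasurePreserving_snd (μ := μ) (ν := μ) |>.ae hs
    filter_upwards [h1, h2] with p hp1 hp2
    exact hC p ⟨hp1.mem, hp2.mem⟩
  have hsw := integral_integral_swap (f := fun A B : M3 => f (Aᵀ * B)) hint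
  have l : ∫ A, ∫ B, f (Aᵀ * B) ∂μ ∂μ = ∫ A, f A ∂μ := by
    have : ∫ A, ∫ B, f (Aᵀ * B) ∂μ ∂μ = ∫ A, (∫ B, f B ∂μ) ∂μ :=
      integral_congr_ae (hs.mono fun A hA => linv hi hf hA.tr)
    rw [this]; simp
  have r : ∫ B, ∫ A, f (Aᵀ * B) ∂μ ∂μ = ∫ A, f Aᵀ ∂μ := by
    have : ∫ B, ∫ A, f (Aᵀ * B) ∂μ ∂μ = ∫ B, (∫ A, f Aᵀ ∂μ) ∂μ := by
      refine integral_congr_ae (hs.mono fun B hB => ?_)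
      have := linv hi (f := fun X => f Xᵀ) (by fun_prop) hB.tr
      simpa [transpose_mul] using this
    rw [this]; simp
  rw [← l, ← r, hsw]

lemma cinv (hs : ∀ᵐ A ∂μ, so3 A)
    (hi : ∀ g, so3 g → Measure.map (fun A => g * A) μ = μ) {f : M3 → ℝ}
    (hf : Continuous f) {g : M3} (hg : so3 g) : ∫ A, f (g * A * gᵀ) ∂μ = ∫ A, f A ∂μ := by
  have h1 := linv hi (f := fun X => f (X * gᵀ)) (by fun_prop) hg
  have h2 := tinv hs hi (f := fun X => f (X * gᵀ)) (by fun_prop)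
  have h3 := linv hi (f := fun X => f Xᵀ) (by fun_prop) hg
  have h4 := tinv hs hi hf
  simp only [transpose_mul] at h3
  rw [h1, ← h2, h3, h4]

def P3 : M3 := !![0,1,0;0,0,1;1,0,0]

lemma P3_so3 : so3 P3 := by
  constructor
  · ext i j; fin_cases i <;> fin_cases j <;> simp [P3, Matrix.mul_apply, Fin.sum_univ_three]
  · simp [P3, det_fin_three]

lemma P3_conj (A : M3) (i j : Fin 3) : (P3 * A * P3ᵀ) i j = A (i+1) (j+1) := by
  fin_cases i <;> fin_cases j <;> simp [P3, Matrix.mul_apply, Fin.sum_univ_three, Matrix.vecMul, dotProduct]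

lemma conj_trace {g : M3} (hg : so3 g) (A : M3) : (g * A * gᵀ).trace = A.trace := by
  rw [trace_mul_comm, ← mul_assoc, hg.1, one_mul]

def D1 : M3 := !![1,0,0;0,-1,0;0,0,-1]
lemma D1_so3 : so3 D1 := by
  constructor
  · ext i j; fin_cases i <;> fin_cases j <;> simp [D1, Matrix.mul_apply, Fin.sum_univ_three]
  · simp [D1, det_fin_three]
def D2 : M3 := !![-1,0,0;0,-1,0;0,0,1]
lemma D2_so3 : so3 D2 := by
  constructor
  · ext i j; fin_cases i <;> fin_cases j <;> simp [D2, Matrix.mul_apply, Fin.sum_univ_three]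
  · simp [D2, det_fin_three]

lemma schur (hs : ∀ᵐ A ∂μ, so3 A)
    (hi : ∀ g, so3 g → Measure.map (fun A => g * A) μ = μ) {h : ℝ → ℝ}
    (hh : Continuous h) (i j : Fin 3) :
    ∫ A, h A.trace * A i j ∂μ = if i = j then (1/3) * ∫ A, h A.trace * A.trace ∂μ else 0 := by
  have hct : Continuous (fun A : M3 => h A.trace) := by fun_prop
  have hc : ∀ i j, Continuous (fun A : M3 => h A.trace * A i j) := fun i j => by fun_prop
  have key : ∀ g, so3 g → ∀ i j,
      ∫ A, h A.trace * (g * A * gᵀ) i j ∂μ = ∫ A, h A.trace * A i j ∂μ := by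
    intro g hg i j
    have := cinv hs hi (hc i j) hg
    simpa only [conj_trace hg] using this
  split_ifs with hij
  · subst hij
    have kp : ∀ i, ∫ A, h A.trace * A (i+1) (i+1) ∂μ = ∫ A, h A.trace * A i i ∂μ := by
      intro i
      have := key P3 P3_so3 i i
      simpa only [P3_conj] using this
    have k0 := kp 0
    have k1 := kp 1
    have e : ∫ A, h A.trace * A.trace ∂μ = ∫ A, h A.trace * A 0 0 ∂μ +
        ∫ A, h A.trace * A 1 1 ∂μ + ∫ A, h A.trace * A 2 2 ∂μ := by
      have e1 := integral_add (integ hs (hc 0 0)) (integ hs (hc 1 1))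
      have e2 := integral_add (f := fun A : M3 => h A.trace * A 0 0 + h A.trace * A 1 1)
        ((integ hs (hc 0 0)).add (integ hs (hc 1 1))) (integ hs (hc 2 2))
      rw [← e1, ← e2]
      congr 1; ext A
      nth_rewrite 2 [trace_fin_three]
      ring
    rw [e]
    change ∫ A, h A.trace * A 1 1 ∂μ = _ at k0
    change ∫ A, h A.trace * A 2 2 ∂μ = _ at k1
    fin_cases i <;> simp only [Fin.mk_one, Fin.zero_eta, Fin.reduceFinMk] <;> linarith
  · have k1 := key D1 D1_so3 i j
    have k2 := key D2 D2_so3 i j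
    fin_cases i <;> fin_cases j <;>
      simp [D1, D2, Matrix.mul_apply, Fin.sum_univ_three, integral_neg, Matrix.vecMul, dotProduct] at k1 k2 hij ⊢ <;> linarith

def Rz (s : ℝ) : M3 := !![Real.cos s, -Real.sin s, 0; Real.sin s, Real.cos s, 0; 0, 0, 1]

lemma Rz_so3 (s : ℝ) : so3 (Rz s) := by
  have := Real.sin_sq_add_cos_sq s
  constructor
  · ext i j; fin_cases i <;> fin_cases j <;>
      simp [Rz, Matrix.mul_apply, Fin.sum_univ_three] <;> nlinarith
  · simp [Rz, det_fin_three]; nlinarith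

lemma deriv_rel (hs : ∀ᵐ A ∂μ, so3 A)
    (hi : ∀ g, so3 g → Measure.map (fun A => g * A) μ = μ) (n : ℕ) :
    ∫ A, (n * A.trace^(n-1) * (A 0 1 - A 1 0)^2 - A.trace^n * (A 0 0 + A 1 1)) ∂μ = 0 := by
  let T : ℝ → M3 → ℝ := fun s A =>
    Real.cos s * (A 0 0 + A 1 1) + Real.sin s * (A 0 1 - A 1 0) + A 2 2
  let W : ℝ → M3 → ℝ := fun s A =>
    Real.cos s * (A 0 1 - A 1 0) - Real.sin s * (A 0 0 + A 1 1)
  let U : ℝ → M3 → ℝ := fun s A =>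
    Real.cos s * (A 0 0 + A 1 1) + Real.sin s * (A 0 1 - A 1 0)
  let F : ℝ → M3 → ℝ := fun s A => T s A ^ n * W s A
  let F' : ℝ → M3 → ℝ := fun s A => n * T s A ^ (n-1) * W s A * W s A + T s A ^ n * (- U s A)
  have hF' : Continuous (fun p : ℝ × M3 => F' p.1 p.2) := by
    simp only [F', T, W, U]; fun_prop
  have hF : ∀ s, Continuous (F s) := by
    intro s; simp only [F, T, W]; fun_prop
  have hF's : ∀ s, Continuous (F' s) := by
    intro s; simp only [F', T, W, U]; fun_prop
  obtain ⟨C, hC⟩ := ((isCompact_Icc (a := (-1:ℝ)) (b := 1)).prod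
    K3_compact).exists_bound_of_continuousOn hF'.continuousOn
  have hd : ∀ s A, HasDerivAt (fun s => F s A) (F' s A) s := by
    intro s A
    have hT : HasDerivAt (fun s => T s A) (W s A) s := by
      have := (((Real.hasDerivAt_cos s).mul_const (A 0 0 + A 1 1)).add
        ((Real.hasDerivAt_sin s).mul_const (A 0 1 - A 1 0))).add_const (A 2 2)
      refine this.congr_deriv ?_
      simp only [W]; ring
    have hW : HasDerivAt (fun s => W s A) (- U s A) s := by
      have := (((Real.hasDerivAt_cos s).mul_const (A 0 1 - A 1 0)).sub
        ((Real.hasDerivAt_sin s).mul_const (A 0 0 + A 1 1)))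
      refine this.congr_deriv ?_
      simp only [U]; ring
    exact (hT.pow n).mul hW
  have main := hasDerivAt_integral_of_dominated_loc_of_deriv_le (μ := μ) (F := F) (F' := F')
    (x₀ := 0) (s := Set.Icc (-1:ℝ) 1) (bound := fun _ => C)
    (Icc_mem_nhds (by norm_num) (by norm_num))
    (Filter.Eventually.of_forall fun s => (hF s).aestronglyMeasurable)
    (integ hs (hF 0)) (hF's 0).aestronglyMeasurable
    (hs.mono fun A hA s hs' => hC (s, A) ⟨hs', hA.mem⟩)
    (integrable_const C)
    (Filter.Eventually.of_forall fun A s _ => hd s A)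
  have hconst : (fun s => ∫ A, F s A ∂μ) = fun _ => ∫ A, F 0 A ∂μ := by
    ext s
    rw [← linv hi (hF 0) (Rz_so3 s)]
    congr 1; ext A
    simp only [F, T, W, Rz, Matrix.mul_apply, Fin.sum_univ_three]
    simp
    ring
  have h0 := main.2
  rw [hconst] at h0
  have := h0.unique (hasDerivAt_const _ _)
  rw [← this]
  congr 1; ext A
  simp [F', T, W, U, trace_fin_three]
  ring

lemma rec_mu (hs : ∀ᵐ A ∂μ, so3 A)
    (hi : ∀ g, so3 g → Measure.map (fun A => g * A) μ = μ) (n : ℕ) :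
    ∫ A, (n * A.trace^(n-1) * ((3 - A.trace) * (1 + A.trace)) - 2 * A.trace^(n+1)) ∂μ = 0 := by
  let G : M3 → ℝ := fun A =>
    n * A.trace^(n-1) * (A 0 1 - A 1 0)^2 - A.trace^n * (A 0 0 + A 1 1)
  have hG : Continuous G := by simp only [G]; fun_prop
  have hP : Continuous (fun A : M3 => G (P3 * A * P3ᵀ)) := by fun_prop
  have hPP : Continuous (fun A : M3 => G (P3 * (P3 * A * P3ᵀ) * P3ᵀ)) := by fun_prop
  have h0 : ∫ A, G A ∂μ = 0 := deriv_rel hs hi n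
  have h1 := cinv hs hi hG P3_so3
  have h2 := cinv hs hi hP P3_so3
  have h3 : ∫ A, (G A + G (P3 * A * P3ᵀ) + G (P3 * (P3 * A * P3ᵀ) * P3ᵀ)) ∂μ = 0 := by
    rw [integral_add (f := fun A => G A + G (P3 * A * P3ᵀ))
      ((integ hs hG).add (integ hs hP)) (integ hs hPP),
      integral_add (integ hs hG) (integ hs hP)]
    rw [h2, h1, h0]; simp
  rw [← h3]
  refine integral_congr_ae (hs.mono fun A hA => ?_)
  simp only [G, conj_trace P3_so3, P3_conj, ← hA.ident]
  have : A.trace ^ (n+1) = A.trace ^ n * (A 0 0 + A 1 1 + A 2 2) := by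
    rw [pow_succ]; nth_rewrite 2 [trace_fin_three]; rfl
  rw [this]
  simp only [show (0:Fin 3)+1 = 1 from rfl, show (1:Fin 3)+1=2 from rfl,
    show (2:Fin 3)+1=0 from rfl]
  ring

end

lemma rec_theta (n : ℕ) :
    ∫ θ in (0:ℝ)..Real.pi, Real.sin (θ/2)^2 *
      (n * (1 + 2 * Real.cos θ)^(n-1) * ((3 - (1 + 2 * Real.cos θ)) * (1 + (1 + 2 * Real.cos θ)))
        - 2 * (1 + 2 * Real.cos θ)^(n+1)) = 0 := by
  have hd : ∀ θ, HasDerivAt (fun θ => (1 + 2 * Real.cos θ)^n *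
      (-(Real.sin θ * (1 - Real.cos θ)))) (Real.sin (θ/2)^2 *
      (n * (1 + 2 * Real.cos θ)^(n-1) * ((3 - (1 + 2 * Real.cos θ)) * (1 + (1 + 2 * Real.cos θ)))
        - 2 * (1 + 2 * Real.cos θ)^(n+1))) θ := by
    intro θ
    have h1 : HasDerivAt (fun θ => 1 + 2 * Real.cos θ) (2 * (-Real.sin θ)) θ :=
      ((Real.hasDerivAt_cos θ).const_mul 2).const_add 1
    have h2 := ((Real.hasDerivAt_sin θ).mul ((Real.hasDerivAt_cos θ).const_sub 1)).neg
    refine ((h1.pow n).mul h2).congr_deriv ?_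
    have e : Real.sin (θ/2)^2 = (1 - Real.cos θ)/2 := by
      have := Real.cos_sq (θ/2)
      have h := Real.sin_sq_add_cos_sq (θ/2)
      rw [show 2 * (θ/2) = θ by ring] at this
      linarith
    have hsc := Real.sin_sq_add_cos_sq θ
    have hsc : Real.sin θ ^ 2 = 1 - Real.cos θ ^ 2 := by linarith
    simp only [Pi.neg_apply, Pi.mul_apply, Pi.pow_apply]
    rw [e, pow_succ (1 + 2 * Real.cos θ) n]
    linear_combination (2 * n * (1 + 2 * Real.cos θ)^(n-1) * (1 - Real.cos θ)
      - (1 + 2 * Real.cos θ)^n) * hsc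
  rw [intervalIntegral.integral_eq_sub_of_hasDerivAt (fun θ _ => hd θ)]
  · simp
  · apply Continuous.intervalIntegrable; fun_prop

lemma sin_half : ∫ θ in (0:ℝ)..Real.pi, Real.sin (θ/2)^2 = Real.pi / 2 := by
  have e : ∀ θ, Real.sin (θ/2)^2 = (1 - Real.cos θ)/2 := by
    intro θ
    have := Real.cos_sq (θ/2)
    have h := Real.sin_sq_add_cos_sq (θ/2)
    rw [show 2 * (θ/2) = θ by ring] at this
    linarith
  simp only [e]
  rw [intervalIntegral.integral_div, intervalIntegral.integral_sub (by simp)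
    (Real.continuous_cos.intervalIntegrable _ _)]
  simp

lemma rec_unique (a b : ℕ → ℝ) (h0 : a 0 = b 0)
    (ha1 : a 1 = 0) (hb1 : b 1 = 0)
    (ha : ∀ n : ℕ, (n+3) * a (n+2) = 3*(n+1) * a n + 2*(n+1) * a (n+1))
    (hb : ∀ n : ℕ, (n+3) * b (n+2) = 3*(n+1) * b n + 2*(n+1) * b (n+1)) : ∀ n, a n = b n := by
  have : ∀ n, a n = b n ∧ a (n+1) = b (n+1) := by
    intro n
    induction n with
    | zero => exact ⟨h0, by simp [ha1, hb1]⟩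
    | succ n ih =>
      refine ⟨ih.2, ?_⟩
      have h1 := ha n
      rw [ih.1, ih.2, ← hb n] at h1
      exact mul_left_cancel₀ (by positivity) h1
  exact fun n => (this n).1

section
variable {μ : Measure M3} [IsProbabilityMeasure μ]

lemma moments (hs : ∀ᵐ A ∂μ, so3 A)
    (hi : ∀ g, so3 g → Measure.map (fun A => g * A) μ = μ) (n : ℕ) :
    ∫ A, A.trace^n ∂μ =
      (2/Real.pi) * ∫ θ in (0:ℝ)..Real.pi, Real.sin (θ/2)^2 * (1 + 2 * Real.cos θ)^n := by
  have hpi := Real.pi_pos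
  have hiA : ∀ n : ℕ, Integrable (fun A : M3 => A.trace^n) μ :=
    fun n => integ hs (by fun_prop)
  have hiT : ∀ n : ℕ, IntervalIntegrable (fun θ => Real.sin (θ/2)^2 * (1 + 2 * Real.cos θ)^n)
      volume 0 Real.pi := fun n => by apply Continuous.intervalIntegrable; fun_prop
  revert n
  apply rec_unique
  · simp [sin_half]
  · have := rec_mu hs hi 0
    simp [integral_neg, integral_const_mul] at this
    simpa using this
  · have := rec_theta 0
    have e : ∀ θ, Real.sin (θ/2)^2 * (1 + 2 * Real.cos θ)^1 = (-1/2) * (Real.sin (θ/2)^2 *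
      (((0:ℕ):ℝ) * (1 + 2 * Real.cos θ)^(0-1) * ((3 - (1 + 2 * Real.cos θ)) * (1 + (1 + 2 * Real.cos θ)))
        - 2 * (1 + 2 * Real.cos θ)^(0+1))) := by intro θ; push_cast; ring
    simp only [e]
    rw [intervalIntegral.integral_const_mul, this]; simp
  · intro n
    have := rec_mu hs hi (n+1)
    have e : ∀ A : M3, (((n+1:ℕ):ℝ) * A.trace^(n+1-1) * ((3 - A.trace) * (1 + A.trace))
        - 2 * A.trace^(n+1+1)) = 3*(n+1) * A.trace^n + 2*(n+1) * A.trace^(n+1)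
          - (n+3) * A.trace^(n+2) := by
      intro A; rw [Nat.add_sub_cancel]; push_cast; ring
    simp only [e] at this
    rw [integral_sub (f := fun A : M3 => 3*(n+1) * A.trace^n + 2*(n+1) * A.trace^(n+1))
      (((hiA n).const_mul _).add ((hiA (n+1)).const_mul _))
      ((hiA (n+2)).const_mul _), integral_add ((hiA n).const_mul _) ((hiA (n+1)).const_mul _),
      integral_const_mul, integral_const_mul, integral_const_mul] at this
    linarith
  · intro n
    have := rec_theta (n+1)
    have e : ∀ θ : ℝ, Real.sin (θ/2)^2 * (((n+1:ℕ):ℝ) * (1 + 2 * Real.cos θ)^(n+1-1) *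
        ((3 - (1 + 2 * Real.cos θ)) * (1 + (1 + 2 * Real.cos θ)))
        - 2 * (1 + 2 * Real.cos θ)^(n+1+1)) =
        3*(n+1) * (Real.sin (θ/2)^2 * (1 + 2 * Real.cos θ)^n)
        + 2*(n+1) * (Real.sin (θ/2)^2 * (1 + 2 * Real.cos θ)^(n+1))
          - (n+3) * (Real.sin (θ/2)^2 * (1 + 2 * Real.cos θ)^(n+2)) := by
      intro A; rw [Nat.add_sub_cancel]; push_cast; ring
    simp only [e] at this
    rw [intervalIntegral.integral_sub (((hiT n).const_mul _).add ((hiT (n+1)).const_mul _))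
      ((hiT (n+2)).const_mul _), intervalIntegral.integral_add ((hiT n).const_mul _)
      ((hiT (n+1)).const_mul _),
      intervalIntegral.integral_const_mul, intervalIntegral.integral_const_mul,
      intervalIntegral.integral_const_mul] at this
    linear_combination (-(2/Real.pi)) * this

lemma weyl_poly (hs : ∀ᵐ A ∂μ, so3 A)
    (hi : ∀ g, so3 g → Measure.map (fun A => g * A) μ = μ) (p : Polynomial ℝ) :
    ∫ A, p.eval A.trace ∂μ =
      (2/Real.pi) * ∫ θ in (0:ℝ)..Real.pi, Real.sin (θ/2)^2 * p.eval (1 + 2 * Real.cos θ) := by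
  induction p using Polynomial.induction_on' with
  | add p q hp hq =>
    simp only [Polynomial.eval_add, mul_add]
    rw [integral_add (integ hs (by fun_prop)) (integ hs (by fun_prop)),
      intervalIntegral.integral_add, hp, hq, mul_add]
    · apply Continuous.intervalIntegrable; fun_prop
    · apply Continuous.intervalIntegrable; fun_prop
  | monomial n a =>
    simp only [Polynomial.eval_monomial, mul_left_comm _ a]
    rw [integral_const_mul, intervalIntegral.integral_const_mul, moments hs hi]
    ring

lemma weyl (hs : ∀ᵐ A ∂μ, so3 A)
    (hi : ∀ g, so3 g → Measure.map (fun A => g * A) μ = μ) {h : ℝ → ℝ} (hh : Continuous h) :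
    ∫ A, h A.trace ∂μ =
      (2/Real.pi) * ∫ θ in (0:ℝ)..Real.pi, Real.sin (θ/2)^2 * h (1 + 2 * Real.cos θ) := by
  have hpi := Real.pi_pos
  refine eq_of_forall_dist_le fun ε hε => ?_
  obtain ⟨p, hp⟩ := exists_polynomial_near_of_continuousOn (-1) 3 h hh.continuousOn
    (ε/4) (by positivity)
  have h1 : |∫ A, h A.trace ∂μ - ∫ A, p.eval A.trace ∂μ| ≤ ε/4 := by
    rw [← integral_sub (integ hs (by fun_prop)) (integ hs (by fun_prop))]
    have := norm_integral_le_of_norm_le_const (μ := μ) (C := ε/4)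
      (f := fun A : M3 => h A.trace - p.eval A.trace) (hs.mono fun A hA => by
        rw [norm_sub_rev]; exact (hp _ hA.range).le)
    simpa using this
  have h2 : |(∫ θ in (0:ℝ)..Real.pi, Real.sin (θ/2)^2 * h (1 + 2 * Real.cos θ)) -
      ∫ θ in (0:ℝ)..Real.pi, Real.sin (θ/2)^2 * p.eval (1 + 2 * Real.cos θ)| ≤ ε/4 * Real.pi := by
    rw [← intervalIntegral.integral_sub]
    · have := intervalIntegral.norm_integral_le_of_norm_le_const (a := 0) (b := Real.pi) (C := ε/4)
        (f := fun θ => Real.sin (θ/2)^2 * h (1 + 2 * Real.cos θ) -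
          Real.sin (θ/2)^2 * p.eval (1 + 2 * Real.cos θ)) (fun θ _ => by
          rw [← mul_sub, norm_mul, norm_sub_rev]
          have a1 : ‖Real.sin (θ/2)^2‖ ≤ 1 := by
            rw [Real.norm_of_nonneg (sq_nonneg _)]; exact Real.sin_sq_le_one _
          have a2 := (hp (1 + 2 * Real.cos θ) ⟨by linarith [Real.neg_one_le_cos θ],
            by linarith [Real.cos_le_one θ]⟩).le
          rw [← Real.norm_eq_abs] at a2
          have := mul_le_mul a1 a2 (norm_nonneg _) zero_le_one
          simpa using this)
      simpa [abs_of_pos hpi] using this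
    · apply Continuous.intervalIntegrable; fun_prop
    · apply Continuous.intervalIntegrable; fun_prop
  have h3 := weyl_poly hs hi p
  rw [Real.dist_eq]
  set X := ∫ A, h A.trace ∂μ
  set Y := ∫ A, p.eval A.trace ∂μ
  set Z := ∫ θ in (0:ℝ)..Real.pi, Real.sin (θ/2)^2 * h (1 + 2 * Real.cos θ)
  set V := ∫ θ in (0:ℝ)..Real.pi, Real.sin (θ/2)^2 * p.eval (1 + 2 * Real.cos θ)
  have e : X - 2/Real.pi * Z = (X - Y) - 2/Real.pi * (Z - V) := by rw [h3]; ring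
  rw [e]
  refine (abs_sub _ _).trans ?_
  rw [abs_mul, abs_of_pos (show 0 < 2/Real.pi by positivity)]
  have : 2/Real.pi * |Z - V| ≤ 2/Real.pi * (ε/4 * Real.pi) := by gcongr
  have e2 : 2/Real.pi * (ε/4 * Real.pi) = ε/2 := by field_simp; norm_num
  linarith

end

/-- Consistency relation for the flux. `μ` is the Haar probability measure of `SO(3)`,
encoded as the unique probability measure on 3×3 matrices carried by `SO(3)` and invariant
under left translation by elements of `SO(3)`. The matrix-valued integral is entrywise. -/
theorem stmt6 (ν : ℝ → ℝ) (hν : Continuous ν) (hνpos : ∀ x, 0 < ν x)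
    (σ : ℝ → ℝ) (hσ : ∀ x, HasDerivAt σ (ν x) x)
    (d : ℝ) (hd : 0 < d)
    (μ : Measure (Matrix (Fin 3) (Fin 3) ℝ)) [IsProbabilityMeasure μ]
    (hμsupp : μ {A | ¬ so3 A} = 0)
    (hμinv : ∀ g, so3 g → Measure.map (fun A => g * A) μ = μ)
    (m : ℝ → ℝ) (hm : ∀ θ, m θ = Real.exp (d⁻¹ * σ (1 / 2 + Real.cos θ)))
    (c₁ : ℝ)
    (hc₁ : c₁ = (2 / 3) *
        (∫ θ in (0:ℝ)..Real.pi, (1 / 2 + Real.cos θ) * Real.sin (θ / 2) ^ 2 * m θ) /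
        ∫ θ in (0:ℝ)..Real.pi, Real.sin (θ / 2) ^ 2 * m θ)
    (Λ : Matrix (Fin 3) (Fin 3) ℝ) (hΛ : so3 Λ) :
    ∀ i j, (∫ A, Real.exp (d⁻¹ * σ ((1 / 2) * (Λᵀ * A).trace)) * A i j ∂μ) =
      c₁ * (∫ A, Real.exp (d⁻¹ * σ ((1 / 2) * (Λᵀ * A).trace)) ∂μ) * Λ i j := by
  have hs : ∀ᵐ A ∂μ, so3 A := hμsupp
  have hσc : Continuous σ := continuous_iff_continuousAt.mpr fun x => (hσ x).continuousAt
  have hpi := Real.pi_pos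
  set h : ℝ → ℝ := fun t => Real.exp (d⁻¹ * σ (1/2 * t)) with hh
  have hc : Continuous h := by simp only [hh]; fun_prop
  have hmh : ∀ θ, m θ = h (1 + 2 * Real.cos θ) := by
    intro θ; rw [hm]; simp only [hh]; congr 3; ring
  intro i j
  have sub : ∀ A : M3, Λᵀ * (Λ * A) = A := fun A => by rw [← mul_assoc, hΛ.1, one_mul]
  have hL : ∫ A, Real.exp (d⁻¹ * σ ((1 / 2) * (Λᵀ * A).trace)) * A i j ∂μ =
      ∫ A, h A.trace * (Λ * A) i j ∂μ := by
    rw [← linv hμinv (f := fun A => Real.exp (d⁻¹ * σ ((1 / 2) * (Λᵀ * A).trace)) * A i j)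
      (by fun_prop) hΛ]
    simp only [sub, hh]
  have hR : ∫ A, Real.exp (d⁻¹ * σ ((1 / 2) * (Λᵀ * A).trace)) ∂μ = ∫ A, h A.trace ∂μ := by
    rw [← linv hμinv (f := fun A => Real.exp (d⁻¹ * σ ((1 / 2) * (Λᵀ * A).trace)))
      (by fun_prop) hΛ]
    simp only [sub, hh]
  have hI : ∫ A, h A.trace * (Λ * A) i j ∂μ =
      ∑ k, Λ i k * ∫ A, h A.trace * A k j ∂μ := by
    simp only [← integral_const_mul]
    rw [← integral_finset_sum]
    · congr 1; ext A
      rw [Matrix.mul_apply, Finset.mul_sum]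
      exact Finset.sum_congr rfl fun k _ => by ring
    · intro k _
      exact integ hs (by fun_prop)
  rw [hL, hR, hI]
  simp only [schur hs hμinv hc]
  simp only [mul_ite, mul_zero, Finset.sum_ite_eq', Finset.mem_univ, if_true]
  have w1 := weyl hs hμinv hc
  have w2 := weyl hs hμinv (h := fun t => h t * t) (by fun_prop)
  have n1 : ∫ θ in (0:ℝ)..Real.pi, (1 / 2 + Real.cos θ) * Real.sin (θ / 2) ^ 2 * m θ =
      (1/2) * ∫ θ in (0:ℝ)..Real.pi, Real.sin (θ / 2) ^ 2 *
        (h (1 + 2 * Real.cos θ) * (1 + 2 * Real.cos θ)) := by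
    rw [← intervalIntegral.integral_const_mul]
    congr 1; ext θ; rw [hmh]; ring
  have n2 : ∫ θ in (0:ℝ)..Real.pi, Real.sin (θ / 2) ^ 2 * m θ =
      ∫ θ in (0:ℝ)..Real.pi, Real.sin (θ / 2) ^ 2 * h (1 + 2 * Real.cos θ) := by
    congr 1; ext θ; rw [hmh]
  have hpos : 0 < ∫ θ in (0:ℝ)..Real.pi, Real.sin (θ / 2) ^ 2 * h (1 + 2 * Real.cos θ) := by
    apply intervalIntegral.intervalIntegral_pos_of_pos_on
    · apply Continuous.intervalIntegrable; fun_prop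
    · intro θ hθ
      have := Real.sin_pos_of_pos_of_lt_pi (x := θ/2) (by linarith [hθ.1])
        (by linarith [hθ.1, hθ.2])
      have : 0 < h (1 + 2 * Real.cos θ) := Real.exp_pos _
      positivity
    · exact hpi
  rw [hc₁, n1, n2, w1, w2]
  field_simp
end
end

section
/- Let ν : ℝ → (0, ∞) be continuous, let σ be an antiderivative of ν, let d > 0, and set m(θ) = exp(d⁻¹ σ(½ + cos θ)). Then the constant c₁ = (2/3) · ( ∫₀^π (½ + cos θ) sin²(θ/2) m(θ) dθ ) / ( ∫₀^π sin²(θ/2) m(θ) dθ ) satisfies 0 < c₁ < 1. -/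
noncomputable section

theorem stmt7 (ν : ℝ → ℝ) (hν : Continuous ν) (hνpos : ∀ x, 0 < ν x)
    (σ : ℝ → ℝ) (hσ : ∀ x, HasDerivAt σ (ν x) x)
    (d : ℝ) (hd : 0 < d)
    (m : ℝ → ℝ) (hm : ∀ θ, m θ = Real.exp (d⁻¹ * σ (1 / 2 + Real.cos θ)))
    (c₁ : ℝ)
    (hc₁ : c₁ = (2 / 3) *
        (∫ θ in (0:ℝ)..Real.pi, (1 / 2 + Real.cos θ) * Real.sin (θ / 2) ^ 2 * m θ) /
        ∫ θ in (0:ℝ)..Real.pi, Real.sin (θ / 2) ^ 2 * m θ) :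
    0 < c₁ ∧ c₁ < 1 := by
  have hσc : Continuous σ := continuous_iff_continuousAt.2 fun x => (hσ x).continuousAt
  have hmono : StrictMono σ := strictMono_of_deriv_pos fun x => by
    rw [(hσ x).deriv]; exact hνpos x
  have hmf : m = fun θ => Real.exp (d⁻¹ * σ (1 / 2 + Real.cos θ)) := funext hm
  have hmc : Continuous m := by rw [hmf]; fun_prop
  have hmpos : ∀ θ, 0 < m θ := fun θ => by rw [hm]; exact Real.exp_pos _
  have hpi := Real.pi_pos
  have hs : ∀ θ, Real.sin (θ / 2) ^ 2 = (1 - Real.cos θ) / 2 := fun θ => by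
    rw [Real.sin_sq_eq_half_sub]
    have : 2 * (θ / 2) = θ := by ring
    rw [this]; ring
  set A := ∫ θ in (0:ℝ)..Real.pi, (1 / 2 + Real.cos θ) * Real.sin (θ / 2) ^ 2 * m θ with hA
  set B := ∫ θ in (0:ℝ)..Real.pi, Real.sin (θ / 2) ^ 2 * m θ with hB
  have hBpos : 0 < B := by
    apply intervalIntegral.integral_pos hpi
    · exact Continuous.continuousOn (by fun_prop)
    · intro x _
      exact mul_nonneg (sq_nonneg _) (hmpos x).le
    · refine ⟨Real.pi, ⟨hpi.le, le_rfl⟩, ?_⟩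
      rw [Real.sin_pi_div_two]; simpa using hmpos _
  have hAB : 0 < 3 / 2 * B - A := by
    rw [hA, hB, ← intervalIntegral.integral_const_mul, ← intervalIntegral.integral_sub
      (Continuous.intervalIntegrable (by fun_prop) _ _)
      (Continuous.intervalIntegrable (by fun_prop) _ _)]
    apply intervalIntegral.integral_pos hpi
    · exact Continuous.continuousOn (by fun_prop)
    · intro x _
      have h1 : 0 ≤ (1 - Real.cos x) * (Real.sin (x / 2) ^ 2 * m x) :=
        mul_nonneg (by linarith [Real.cos_le_one x]) (mul_nonneg (sq_nonneg _) (hmpos x).le)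
      linarith
    · refine ⟨Real.pi, ⟨hpi.le, le_rfl⟩, ?_⟩
      rw [Real.sin_pi_div_two, Real.cos_pi]; linarith [hmpos Real.pi]
  have hZ : ∫ θ in (0:ℝ)..Real.pi, (1 / 2 + Real.cos θ) * Real.sin (θ / 2) ^ 2 = 0 := by
    rw [intervalIntegral.integral_eq_sub_of_hasDerivAt
      (f := fun θ => Real.sin θ / 4 - Real.sin θ * Real.cos θ / 4)]
    · simp
    · intro x _
      have := ((Real.hasDerivAt_sin x).div_const 4).sub
        (((Real.hasDerivAt_sin x).mul (Real.hasDerivAt_cos x)).div_const 4)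
      refine this.congr_deriv ?_
      rw [hs]
      nlinarith [Real.sin_sq_add_cos_sq x]
    · exact Continuous.intervalIntegrable (by fun_prop) _ _
  have hApos : 0 < A := by
    have h0 : A = ∫ θ in (0:ℝ)..Real.pi, ((1 / 2 + Real.cos θ) * Real.sin (θ / 2) ^ 2 * m θ
        - (1 / 2 + Real.cos θ) * Real.sin (θ / 2) ^ 2 * Real.exp (d⁻¹ * σ 0)) := by
      rw [intervalIntegral.integral_sub
        (Continuous.intervalIntegrable (by fun_prop) _ _)
        (Continuous.intervalIntegrable (by fun_prop) _ _),
        intervalIntegral.integral_mul_const, hZ]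
      simp [hA]
    have hd' := inv_pos.2 hd
    rw [h0]
    apply intervalIntegral.integral_pos hpi
    · exact Continuous.continuousOn (by fun_prop)
    · intro x _
      have h1 : 0 ≤ (1 / 2 + Real.cos x) * (m x - Real.exp (d⁻¹ * σ 0)) := by
        rw [hm]
        rcases le_total 0 (1 / 2 + Real.cos x) with h | h
        · refine mul_nonneg h (sub_nonneg.2 (Real.exp_le_exp.2 ?_))
          exact mul_le_mul_of_nonneg_left (hmono.monotone h) hd'.le
        · refine mul_nonneg_of_nonpos_of_nonpos h (sub_nonpos.2 (Real.exp_le_exp.2 ?_))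
          exact mul_le_mul_of_nonneg_left (hmono.monotone h) hd'.le
      have h2 := mul_nonneg (sq_nonneg (Real.sin (x / 2))) h1
      linarith
    · refine ⟨Real.pi, ⟨hpi.le, le_rfl⟩, ?_⟩
      have : m Real.pi < Real.exp (d⁻¹ * σ 0) := by
        rw [hm, Real.cos_pi]
        exact Real.exp_lt_exp.2 (mul_lt_mul_of_pos_left (hmono (by norm_num)) hd')
      rw [Real.sin_pi_div_two, Real.cos_pi]; linarith
  rw [hc₁]
  refine ⟨by positivity, ?_⟩
  rw [div_lt_one hBpos]; linarith
end
end

section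
/- Let ν : ℝ → (0, ∞) be continuous and let σ be an antiderivative of ν. For d > 0 set m_d(θ) = exp(d⁻¹ σ(½ + cos θ)) and c₁(d) = (2/3) · ( ∫₀^π (½ + cos θ) sin²(θ/2) m_d(θ) dθ ) / ( ∫₀^π sin²(θ/2) m_d(θ) dθ ). Then c₁(d) → 0 as d → ∞, and c₁(d) → 1 as d → 0⁺. -/
noncomputable section

open Real Filter Topology

lemma aux_D_pos (σ : ℝ → ℝ) (hc : Continuous σ) (s : ℝ) :
    0 < ∫ θ in (0:ℝ)..π, sin (θ / 2) ^ 2 * exp (s * σ (1 / 2 + cos θ)) := by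
  apply intervalIntegral.integral_pos pi_pos
  · fun_prop
  · intro x _; positivity
  · refine ⟨π, ⟨pi_pos.le, le_rfl⟩, ?_⟩
    rw [sin_pi_div_two]; positivity

lemma aux_bound (σ : ℝ → ℝ) (hc : Continuous σ) (hmono : StrictMono σ) (ε : ℝ) (h0 : 0 < ε)
    (h1 : ε < 1) : ∃ K a : ℝ, 0 < a ∧ ∀ s : ℝ, 0 < s →
    (∫ θ in (0:ℝ)..π, (1 - cos θ) * (sin (θ / 2) ^ 2 * exp (s * σ (1 / 2 + cos θ)))) ≤
      (ε + K * exp (-(s * a))) *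
        ∫ θ in (0:ℝ)..π, sin (θ / 2) ^ 2 * exp (s * σ (1 / 2 + cos θ)) := by
  set C := ∫ θ in (0:ℝ)..π, sin (θ / 2) ^ 2 * max 0 (ε / 2 - (1 - cos θ)) with hC
  set W := ∫ θ in (0:ℝ)..π, 2 * sin (θ / 2) ^ 2 with hW
  have hCpos : 0 < C := by
    apply intervalIntegral.integral_pos pi_pos
    · fun_prop
    · intro x _; positivity
    · refine ⟨ε, ⟨h0.le, by linarith [pi_gt_three]⟩, ?_⟩
      have h2 : 0 < sin (ε / 2) := sin_pos_of_pos_of_lt_pi (by linarith) (by linarith [pi_gt_three])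
      have h3 := one_sub_sq_div_two_le_cos (x := ε)
      have h4 : 0 < ε / 2 - (1 - cos ε) := by nlinarith
      have h5 : 0 < max 0 (ε / 2 - (1 - cos ε)) := lt_max_of_lt_right h4
      positivity
  have hWnn : 0 ≤ W := by
    apply intervalIntegral.integral_nonneg pi_pos.le
    intro x _; positivity
  refine ⟨W / C, σ (3 / 2 - ε / 2) - σ (3 / 2 - ε), sub_pos.2 (hmono (by linarith)), ?_⟩
  intro s hs
  set D := ∫ θ in (0:ℝ)..π, sin (θ / 2) ^ 2 * exp (s * σ (1 / 2 + cos θ)) with hD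
  have hN : (∫ θ in (0:ℝ)..π, (1 - cos θ) * (sin (θ / 2) ^ 2 * exp (s * σ (1 / 2 + cos θ)))) ≤
      ε * D + exp (s * σ (3 / 2 - ε)) * W := by
    rw [hD, hW, ← intervalIntegral.integral_const_mul, ← intervalIntegral.integral_const_mul,
      ← intervalIntegral.integral_add
        (Continuous.intervalIntegrable (by fun_prop) _ _)
        (Continuous.intervalIntegrable (by fun_prop) _ _)]
    apply intervalIntegral.integral_mono_on pi_pos.le
      (Continuous.intervalIntegrable (by fun_prop) _ _)
      (Continuous.intervalIntegrable (by fun_prop) _ _)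
    intro x _
    have hw : 0 ≤ sin (x / 2) ^ 2 := by positivity
    rcases le_total (1 - cos x) ε with h | h
    · have : (1 - cos x) * (sin (x / 2) ^ 2 * exp (s * σ (1 / 2 + cos x))) ≤
        ε * (sin (x / 2) ^ 2 * exp (s * σ (1 / 2 + cos x))) := by gcongr
      have h' : 0 ≤ exp (s * σ (3 / 2 - ε)) * (2 * sin (x / 2) ^ 2) := by positivity
      linarith
    · have e1 : exp (s * σ (1 / 2 + cos x)) ≤ exp (s * σ (3 / 2 - ε)) := by
        gcongr
        exact hmono.monotone (by linarith)
      have h2 : 1 - cos x ≤ 2 := by linarith [neg_one_le_cos x]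
      have : (1 - cos x) * (sin (x / 2) ^ 2 * exp (s * σ (1 / 2 + cos x))) ≤
        2 * (sin (x / 2) ^ 2 * exp (s * σ (3 / 2 - ε))) := by gcongr
      have h' : 0 ≤ ε * (sin (x / 2) ^ 2 * exp (s * σ (1 / 2 + cos x))) := by positivity
      linarith
  have hDl : exp (s * σ (3 / 2 - ε / 2)) * C ≤ D := by
    rw [hD, hC, ← intervalIntegral.integral_const_mul]
    apply intervalIntegral.integral_mono_on pi_pos.le
      (Continuous.intervalIntegrable (by fun_prop) _ _)
      (Continuous.intervalIntegrable (by fun_prop) _ _)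
    intro x _
    have hw : 0 ≤ sin (x / 2) ^ 2 := by positivity
    rcases le_total (ε / 2 - (1 - cos x)) 0 with h | h
    · rw [max_eq_left h]
      simp only [mul_zero]
      positivity
    · rw [max_eq_right h]
      have e1 : exp (s * σ (3 / 2 - ε / 2)) ≤ exp (s * σ (1 / 2 + cos x)) := by
        gcongr
        exact hmono.monotone (by linarith)
      have h2 : ε / 2 - (1 - cos x) ≤ 1 := by linarith [cos_le_one x]
      calc _ ≤ exp (s * σ (1 / 2 + cos x)) * (sin (x / 2) ^ 2 * 1) := by gcongr
        _ = _ := by ring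
  have he : exp (s * σ (3 / 2 - ε)) =
      exp (-(s * (σ (3 / 2 - ε / 2) - σ (3 / 2 - ε)))) * exp (s * σ (3 / 2 - ε / 2)) := by
    rw [← exp_add]; congr 1; ring
  have hfin : exp (s * σ (3 / 2 - ε)) * W ≤
      (W / C * exp (-(s * (σ (3 / 2 - ε / 2) - σ (3 / 2 - ε))))) * D := by
    rw [he]
    calc _ = (W / C * exp (-(s * (σ (3 / 2 - ε / 2) - σ (3 / 2 - ε))))) *
          (exp (s * σ (3 / 2 - ε / 2)) * C) := by field_simp
      _ ≤ _ := by gcongr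
  linarith

lemma aux_int : ∫ θ in (0:ℝ)..π, (1 / 2 + cos θ) * sin (θ / 2) ^ 2 = 0 := by
  have : ∀ θ : ℝ, (1 / 2 + cos θ) * sin (θ / 2) ^ 2 = (1/4 + 1/4 * cos θ) - 1/2 * cos θ ^ 2 := by
    intro θ
    have h := cos_sq' (θ / 2)
    have h2 := cos_sq (θ / 2)
    rw [show 2 * (θ / 2) = θ by ring] at h2
    have : sin (θ / 2) ^ 2 = 1 / 2 - cos θ / 2 := by linarith
    rw [this]; ring
  simp only [this]
  rw [intervalIntegral.integral_sub (Continuous.intervalIntegrable (by fun_prop) _ _)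
        (Continuous.intervalIntegrable (by fun_prop) _ _),
     intervalIntegral.integral_add (Continuous.intervalIntegrable (by fun_prop) _ _)
        (Continuous.intervalIntegrable (by fun_prop) _ _),
     intervalIntegral.integral_const_mul, intervalIntegral.integral_const_mul,
     integral_cos_sq, integral_cos]
  simp
  ring

theorem stmt8 (ν : ℝ → ℝ) (hν : Continuous ν) (hνpos : ∀ x, 0 < ν x)
    (σ : ℝ → ℝ) (hσ : ∀ x, HasDerivAt σ (ν x) x)
    (m : ℝ → ℝ → ℝ) (hm : ∀ d θ, m d θ = Real.exp (d⁻¹ * σ (1 / 2 + Real.cos θ)))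
    (c₁ : ℝ → ℝ)
    (hc₁ : ∀ d, 0 < d → c₁ d = (2 / 3) *
        (∫ θ in (0:ℝ)..Real.pi, (1 / 2 + Real.cos θ) * Real.sin (θ / 2) ^ 2 * m d θ) /
        ∫ θ in (0:ℝ)..Real.pi, Real.sin (θ / 2) ^ 2 * m d θ) :
    Filter.Tendsto c₁ Filter.atTop (nhds 0) ∧
      Filter.Tendsto c₁ (nhdsWithin 0 (Set.Ioi 0)) (nhds 1) := by
  have hc : Continuous σ := continuous_iff_continuousAt.2 fun x => (hσ x).continuousAt
  have hmono : StrictMono σ := strictMono_of_deriv_pos fun x => by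
    rw [(hσ x).deriv]; exact hνpos x
  simp only [hm] at hc₁
  constructor
  · set F : ℝ → ℝ := fun s => (2 / 3) *
        (∫ θ in (0:ℝ)..π, (1 / 2 + cos θ) * sin (θ / 2) ^ 2 * exp (s * σ (1 / 2 + cos θ))) /
        ∫ θ in (0:ℝ)..π, sin (θ / 2) ^ 2 * exp (s * σ (1 / 2 + cos θ)) with hF
    have hFc : Continuous F := by
      apply Continuous.div
      · apply Continuous.mul continuous_const
        apply intervalIntegral.continuous_parametric_intervalIntegral_of_continuous'
        simp only [Function.uncurry_def]
        fun_prop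
      · apply intervalIntegral.continuous_parametric_intervalIntegral_of_continuous'
        simp only [Function.uncurry_def]
        fun_prop
      · intro s
        exact (aux_D_pos σ hc s).ne'
    have hF0 : F 0 = 0 := by
      have := aux_int
      simp only [hF, zero_mul, exp_zero, mul_one, this, mul_zero, zero_div]
    have h1 : Tendsto (fun d : ℝ => F d⁻¹) atTop (𝓝 0) := by
      have := (hFc.tendsto 0).comp (tendsto_inv_atTop_zero (𝕜 := ℝ))
      rwa [hF0] at this
    refine h1.congr' ?_
    filter_upwards [eventually_gt_atTop 0] with d hd
    rw [hc₁ d hd]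
  · rw [Metric.tendsto_nhds]
    intro η hη
    obtain ⟨ε, h0, h1, hεη⟩ : ∃ ε : ℝ, 0 < ε ∧ ε < 1 ∧ 2 * ε ≤ η :=
      ⟨min (1/2) (η/2), by positivity, by linarith [min_le_left (1/2) (η/2)],
        by linarith [min_le_right (1/2) (η/2)]⟩
    obtain ⟨K, a, ha, hb⟩ := aux_bound σ hc hmono ε h0 h1
    have hlim : Tendsto (fun d : ℝ => K * exp (-(d⁻¹ * a))) (𝓝[>] 0) (𝓝 0) := by
      have := (tendsto_exp_neg_atTop_nhds_zero.comp
        ((tendsto_inv_nhdsGT_zero (𝕜 := ℝ)).atTop_mul_const ha)).const_mul K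
      simpa using this
    filter_upwards [hlim.eventually (gt_mem_nhds h0), self_mem_nhdsWithin] with d hd hdpos
    have hdpos : 0 < d := hdpos
    have hB := hb d⁻¹ (inv_pos.2 hdpos)
    have hDp := aux_D_pos σ hc d⁻¹
    have hNn : 0 ≤ ∫ θ in (0:ℝ)..π,
        (1 - cos θ) * (sin (θ / 2) ^ 2 * exp (d⁻¹ * σ (1 / 2 + cos θ))) := by
      apply intervalIntegral.integral_nonneg pi_pos.le
      intro x _
      have : 0 ≤ 1 - cos x := by linarith [cos_le_one x]
      positivity
    have hsplit : (∫ θ in (0:ℝ)..π,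
          (1 / 2 + cos θ) * sin (θ / 2) ^ 2 * exp (d⁻¹ * σ (1 / 2 + cos θ))) =
        3 / 2 * (∫ θ in (0:ℝ)..π, sin (θ / 2) ^ 2 * exp (d⁻¹ * σ (1 / 2 + cos θ))) -
        ∫ θ in (0:ℝ)..π,
          (1 - cos θ) * (sin (θ / 2) ^ 2 * exp (d⁻¹ * σ (1 / 2 + cos θ))) := by
      rw [← intervalIntegral.integral_const_mul, ← intervalIntegral.integral_sub
        (Continuous.intervalIntegrable (by fun_prop) _ _)
        (Continuous.intervalIntegrable (by fun_prop) _ _)]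
      congr 1; ext θ; ring
    rw [hc₁ d hdpos, hsplit]
    set D := ∫ θ in (0:ℝ)..π, sin (θ / 2) ^ 2 * exp (d⁻¹ * σ (1 / 2 + cos θ))
    set N := ∫ θ in (0:ℝ)..π,
          (1 - cos θ) * (sin (θ / 2) ^ 2 * exp (d⁻¹ * σ (1 / 2 + cos θ)))
    have e : 2 / 3 * (3 / 2 * D - N) / D - 1 = - (2 / 3 * (N / D)) := by
      field_simp; ring
    have hR : N / D ≤ ε + K * exp (-(d⁻¹ * a)) := (div_le_iff₀ hDp).2 hB
    have hR0 : 0 ≤ N / D := by positivity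
    rw [Real.dist_eq, e, abs_neg, abs_of_nonneg (by positivity)]
    linarith
end
end
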